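/- arXiv:2403.06882 — 2 statements merged into one kernel-verified Lean document; each statement's English description precedes it below -/
import Mathlib

section
/- Let η ≠ 0, β ∈ ℂ, n ≥ 1, and let ū = (u_1,…,u_n) and v̄ = (v_1,…,v_{n−1}) be tuples of complex numbers such that: the u_j are pairwise distinct, the v_j are pairwise distinct, u_a ≠ v_b for all a, b, and u_a − u_b ∉ {η,−η}, v_a − v_b ∉ {η,−η} (a ≠ b), u_a − v_b ∉ {η,−η} for all a, b. Consider the sum over all partitions of the entries of ū into three disjoint subsets ū₀, ū₁, ū₂ with #ū₀ = 1, and of the entries of v̄ into two disjoint subsets v̄₁, v̄₂ with #v̄₁ = #ū₁ (hence #v̄₂ = #ū₂): Σ K_{#ū₁}(v̄₁|ū₁) · K_{#ū₂}(ū₂|v̄₂) · e^{(#ū₂)β} · f(v̄₂,v̄₁) f(ū₁,ū₂) f(ū₁,ū₀) f(ū₀,ū₂). This sum equals Δ'(v̄) Δ(ū) h(ū,v̄) · det_n M, where M_{jk} = e^β t(u_k,v_j) − t(v_j,u_k)·h(u_k,ū) h(v̄,u_k)/(h(ū,u_k) h(u_k,v̄)) for 1 ≤ j ≤ n−1, and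 M_{nk} = h(u_k,ū)/h(u_k,v̄). -/
open Finset

noncomputable section


/-- `g(u,v) = η/(u−v)` -/
def gg (η u v : ℂ) : ℂ := η / (u - v)

/-- `f(u,v) = (u−v+η)/(u−v)` -/
def ff (η u v : ℂ) : ℂ := (u - v + η) / (u - v)

/-- `h(u,v) = (u−v+η)/η` -/
def hh (η u v : ℂ) : ℂ := (u - v + η) / η

/-- `t(u,v) = η²/((u−v)(u−v+η))` -/
def tt (η u v : ℂ) : ℂ := η ^ 2 / ((u - v) * (u - v + η))

/-- `Δ(w̄) = Π_{j<k} g(w_k,w_j)` -/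
def Delta (η : ℂ) {n : ℕ} (w : Fin n → ℂ) : ℂ :=
  ∏ j : Fin n, ∏ k ∈ Finset.univ.filter (fun k => j < k), gg η (w k) (w j)

/-- `Δ'(w̄) = Π_{j<k} g(w_j,w_k)` -/
def Delta' (η : ℂ) {n : ℕ} (w : Fin n → ℂ) : ℂ :=
  ∏ j : Fin n, ∏ k ∈ Finset.univ.filter (fun k => j < k), gg η (w j) (w k)

/-- The highest coefficient `K_N(v̄|ū)`. -/
def Kc (η : ℂ) (N : ℕ) (v u : Fin N → ℂ) : ℂ :=
  Delta' η v * Delta η u * (∏ j, ∏ k, hh η (v j) (u k)) *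
    Matrix.det (Matrix.of fun j k : Fin N => tt η (v j) (u k))

/-- The `m`-tuple of values of `w` on the finset `S`, listed in increasing index order
(meaningful when `S.card = m`). -/
def subT {n : ℕ} (w : Fin n → ℂ) (S : Finset (Fin n)) (m : ℕ) : Fin m → ℂ :=
  fun i => ((S.sort (· ≤ ·)).map w).getD i 0

/-- The field form-factor function `Ψ_{m+1}(v̄,ū|β)` with an `m`-tuple `v̄` and an
`(m+1)`-tuple `ū`, given by its determinant representation. -/
def Psi (η β : ℂ) (m : ℕ) (v : Fin m → ℂ) (u : Fin (m + 1) → ℂ) : ℂ :=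
  Delta' η v * Delta η u * (∏ a, ∏ b, hh η (u a) (v b)) *
    Matrix.det (Matrix.of fun j k : Fin (m + 1) =>
      if hj : (j : ℕ) < m then
        Complex.exp β * tt η (u k) (v ⟨j, hj⟩) -
          tt η (v ⟨j, hj⟩) (u k) * ((∏ a, hh η (u k) (u a)) * ∏ a, hh η (v a) (u k)) /
            ((∏ a, hh η (u a) (u k)) * ∏ a, hh η (u k) (v a))
      else (∏ a, hh η (u k) (u a)) / (∏ a, hh η (u k) (v a)))


/-- The Izergin coefficient `K(x̄|v̄_T)` defined by expansion over the poles in the first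
entry of the list `x̄`. -/
def recK (η : ℂ) {ι : Type*} [DecidableEq ι] (v : ι → ℂ) : List ℂ → Finset ι → ℂ
  | [], T => if T = ∅ then 1 else 0
  | a :: xs, T => ∑ j ∈ T, gg η a (v j) * (∏ i ∈ T.erase j, ff η (v j) (v i)) *
      (xs.map fun x => ff η x (v j)).prod * recK η v xs (T.erase j)

section recK

variable {ι : Type*} [DecidableEq ι] (η : ℂ) (v : ι → ℂ)

theorem recK_eq_zero_of_card_ne (xs : List ℂ) (T : Finset ι) (h : T.card ≠ xs.length) :
    recK η v xs T = 0 := by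
  induction xs generalizing T with
  | nil => simpa [recK] using h
  | cons a xs ih =>
    refine Finset.sum_eq_zero fun j hj => ?_
    rw [ih, mul_zero]
    have := Finset.card_erase_add_one hj
    simp only [List.length_cons] at h
    omega

theorem recK_append (β α : List ℂ) (U : Finset ι) :
    recK η v (β ++ α) U = ∑ T ∈ U.powerset, recK η v α T * recK η v β (U \ T) *
      (∏ a ∈ U \ T, ∏ b ∈ T, ff η (v a) (v b)) *
      ∏ a ∈ U \ T, (α.map fun x => ff η x (v a)).prod := by
  induction β generalizing U with
  | nil =>
    rw [Finset.sum_eq_single U]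
    · simp [recK]
    · intro T hT hne
      have : U \ T ≠ ∅ := fun h =>
        hne (Finset.Subset.antisymm (Finset.mem_powerset.1 hT) (Finset.sdiff_eq_empty_iff_subset.1 h))
      simp [recK, this]
    · simp
  | cons b β ih =>
    simp only [List.cons_append, recK, ih, Finset.mul_sum, Finset.sum_mul]
    rw [Finset.sum_comm' (s' := fun T => U \ T) (t' := U.powerset)]
    · refine Finset.sum_congr rfl fun T hT => Finset.sum_congr rfl fun j hj => ?_
      have hTU := Finset.mem_powerset.1 hT
      obtain ⟨hjU, hjT⟩ := Finset.mem_sdiff.1 hj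
      have h1 : U.erase j = T ∪ (U \ T).erase j := by
        ext i; simp only [Finset.mem_erase, Finset.mem_union, Finset.mem_sdiff]
        have := @hTU i
        grind
      have h2 : U.erase j \ T = (U \ T).erase j := by
        ext i; simp only [Finset.mem_erase, Finset.mem_sdiff]; tauto
      have hd : Disjoint T ((U \ T).erase j) := by
        rw [Finset.disjoint_left]; intro i hi; simp [hi]
      rw [h2, h1, Finset.prod_union hd, ← Finset.mul_prod_erase _ _ hj,
        ← Finset.mul_prod_erase (U \ T) (fun a => (α.map fun x => ff η x (v a)).prod) hj,
        List.map_append, List.prod_append]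
      ring
    · intro j T
      simp only [Finset.mem_powerset, Finset.mem_sdiff]
      constructor
      · rintro ⟨hj, hT⟩
        exact ⟨⟨hj, fun h => by simpa using hT h⟩, hT.trans (Finset.erase_subset _ _)⟩
      · rintro ⟨⟨hj, hjT⟩, hT⟩
        exact ⟨hj, fun i hi => Finset.mem_erase.2 ⟨fun h => hjT (h ▸ hi), hT hi⟩⟩

theorem recK_swap (hv : Function.Injective v) (a b : ℂ) (xs : List ℂ) (T : Finset ι)
    (ha : ∀ j, a ≠ v j) (hb : ∀ j, b ≠ v j) :
    recK η v (a :: b :: xs) T = recK η v (b :: a :: xs) T := by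
  have expand : ∀ a b : ℂ, recK η v (a :: b :: xs) T = ∑ j ∈ T, ∑ k ∈ T.erase j,
      gg η a (v j) * gg η b (v k) * ff η (v j) (v k) * ff η b (v j) *
      ((∏ i ∈ (T.erase j).erase k, ff η (v j) (v i)) *
        (∏ i ∈ (T.erase j).erase k, ff η (v k) (v i)) *
        (xs.map fun x => ff η x (v j)).prod * (xs.map fun x => ff η x (v k)).prod *
        recK η v xs ((T.erase j).erase k)) := by
    intro a b
    simp only [recK, Finset.mul_sum, List.map_cons, List.prod_cons]
    refine Finset.sum_congr rfl fun j _ => Finset.sum_congr rfl fun k hk => ?_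
    rw [← Finset.mul_prod_erase (T.erase j) _ hk]
    ring
  have flip : ∀ F : ι → ι → ℂ, ∑ j ∈ T, ∑ k ∈ T.erase j, F j k =
      ∑ j ∈ T, ∑ k ∈ T.erase j, F k j := by
    intro F
    refine Finset.sum_comm' fun j k => ?_
    simp only [Finset.mem_erase]; tauto
  have double : ∀ F : ι → ι → ℂ, 2 * ∑ j ∈ T, ∑ k ∈ T.erase j, F j k =
      ∑ j ∈ T, ∑ k ∈ T.erase j, (F j k + F k j) := by
    intro F
    simp only [Finset.sum_add_distrib]
    rw [← flip F]; ring
  refine mul_left_cancel₀ (two_ne_zero (α := ℂ)) ?_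
  rw [expand, expand, double, double]
  refine Finset.sum_congr rfl fun j _ => Finset.sum_congr rfl fun k hk => ?_
  rw [Finset.erase_right_comm (a := k)]
  have hjk : v j - v k ≠ 0 := sub_ne_zero.2 fun h => (Finset.mem_erase.1 hk).1 (hv h).symm
  have hkj : v k - v j ≠ 0 := by rw [← neg_sub]; exact neg_ne_zero.2 hjk
  have h1 := sub_ne_zero.2 (ha j)
  have h2 := sub_ne_zero.2 (ha k)
  have h3 := sub_ne_zero.2 (hb j)
  have h4 := sub_ne_zero.2 (hb k)
  have key : gg η a (v j) * gg η b (v k) * ff η (v j) (v k) * ff η b (v j) +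
      gg η a (v k) * gg η b (v j) * ff η (v k) (v j) * ff η b (v k) =
      gg η b (v j) * gg η a (v k) * ff η (v j) (v k) * ff η a (v j) +
      gg η b (v k) * gg η a (v j) * ff η (v k) (v j) * ff η a (v k) := by
    simp only [gg, ff]
    rw [← neg_sub (v j) (v k)]
    field_simp
    ring
  linear_combination ((∏ i ∈ (T.erase j).erase k, ff η (v j) (v i)) *
        (∏ i ∈ (T.erase j).erase k, ff η (v k) (v i)) *
        (xs.map fun x => ff η x (v j)).prod * (xs.map fun x => ff η x (v k)).prod *
        recK η v xs ((T.erase j).erase k)) * key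

theorem recK_perm (hv : Function.Injective v) {xs ys : List ℂ} (h : xs.Perm ys)
    (hx : ∀ a ∈ xs, ∀ j, a ≠ v j) (T : Finset ι) : recK η v xs T = recK η v ys T := by
  induction h generalizing T with
  | nil => rfl
  | cons a h ih =>
    simp only [recK]
    refine Finset.sum_congr rfl fun j _ => ?_
    rw [ih (fun b hb => hx b (List.mem_cons_of_mem _ hb)), (h.map _).prod_eq]
  | swap a b xs => exact recK_swap η v hv _ _ _ _ (hx _ (by simp)) (hx _ (by simp))
  | trans h₁ _ ih₁ ih₂ =>
    rw [ih₁ hx, ih₂ fun a ha => hx a (h₁.mem_iff.2 ha)]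

end recK

section Recursion

theorem prod_lt_succAbove {N : ℕ} (φ : Fin (N + 1) → Fin (N + 1) → ℂ) (j : Fin (N + 1)) :
    ∏ a, ∏ b ∈ Finset.univ.filter (fun b => a < b), φ a b =
      (∏ i, if j < j.succAbove i then φ j (j.succAbove i) else φ (j.succAbove i) j) *
        ∏ a : Fin N, ∏ b ∈ Finset.univ.filter (fun b => a < b),
          φ (j.succAbove a) (j.succAbove b) := by
  simp only [Finset.prod_filter]
  rw [Fin.prod_univ_succAbove _ j, Fin.prod_univ_succAbove _ j]
  simp only [lt_self_iff_false, if_false, one_mul]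
  simp_rw [fun a : Fin N => Fin.prod_univ_succAbove
    (fun b => if j.succAbove a < b then φ (j.succAbove a) b else 1) j]
  rw [Finset.prod_mul_distrib, ← mul_assoc, ← Finset.prod_mul_distrib]
  simp only [(Fin.strictMono_succAbove j).lt_iff_lt]
  congr 1
  refine Finset.prod_congr rfl fun i _ => ?_
  have := Fin.succAbove_ne j i
  rcases lt_or_gt_of_ne this with h | h
  · simp [h, h.not_gt]
  · simp [h, h.not_gt]

theorem prod_sign_succAbove {N : ℕ} (j : Fin (N + 1)) :
    (∏ i : Fin N, if j < j.succAbove i then (-1 : ℂ) else 1) = (-1) ^ (N + (j : ℕ)) := by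
  have h : (∏ i : Fin N, if j < j.succAbove i then (-1 : ℂ) else 1) *
      (-1) ^ (j : ℕ) = (-1) ^ N := by
    have h2 : (∏ i : Fin N, if j < j.succAbove i then (1 : ℂ) else -1) = (-1) ^ (j : ℕ) := by
      rw [Finset.prod_ite, Finset.prod_const_one, one_mul, Finset.prod_const]
      congr 1
      have : (Finset.univ.filter fun i : Fin N => ¬ j < j.succAbove i) =
          Finset.univ.filter fun i : Fin N => (i : ℕ) < j := by
        ext i
        rw [Finset.mem_filter, Finset.mem_filter, Fin.lt_succAbove_iff_le_castSucc, not_le,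
          Fin.lt_def, Fin.val_castSucc]
      rw [this, Fin.card_filter_val_lt]
      omega
    rw [← h2, ← Finset.prod_mul_distrib]
    have : ∀ i : Fin N, (if j < j.succAbove i then (-1 : ℂ) else 1) *
        (if j < j.succAbove i then (1 : ℂ) else -1) = -1 := by
      intro i; split_ifs <;> norm_num
    simp [this]
  have h3 : ((-1 : ℂ) ^ (j : ℕ)) * (-1) ^ (j : ℕ) = 1 := by
    rw [← mul_pow]; norm_num
  rw [pow_add, ← h, mul_assoc, h3, mul_one]

theorem gg_swap (η a b : ℂ) : gg η a b = -gg η b a := by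
  rw [gg, gg, ← neg_sub b a, div_neg]

theorem Delta_succAbove (η : ℂ) {N : ℕ} (w : Fin (N + 1) → ℂ) (j : Fin (N + 1)) :
    Delta η w = (-1) ^ (N + (j : ℕ)) * (∏ i, gg η (w j) (w (j.succAbove i))) *
      Delta η (fun i => w (j.succAbove i)) := by
  have h : (∏ i, if j < j.succAbove i then gg η (w (j.succAbove i)) (w j)
      else gg η (w j) (w (j.succAbove i))) =
      (-1) ^ (N + (j : ℕ)) * ∏ i, gg η (w j) (w (j.succAbove i)) := by
    rw [← prod_sign_succAbove, ← Finset.prod_mul_distrib]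
    refine Finset.prod_congr rfl fun i _ => ?_
    split_ifs
    · rw [gg_swap]; ring
    · ring
  rw [Delta, prod_lt_succAbove (fun a b => gg η (w b) (w a)) j, h, Delta]

theorem Delta'_succ (η : ℂ) {N : ℕ} (w : Fin (N + 1) → ℂ) :
    Delta' η w = (∏ i : Fin N, gg η (w 0) (w i.succ)) * Delta' η (fun i => w i.succ) := by
  rw [Delta', prod_lt_succAbove (fun a b => gg η (w a) (w b)) 0, Delta']
  simp only [Fin.succAbove_zero, Fin.succ_pos, if_true]

theorem prod_div_eq_one_add_sum {N : ℕ} (η : ℂ) (x y : Fin N → ℂ) (hx : Function.Injective x)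
    (z : ℂ) (hz : ∀ k, z ≠ x k) :
    (∏ i, (z + η - y i)) = (∏ k, (z - x k)) *
      (1 + ∑ k, Lagrange.nodalWeight Finset.univ x k * (z - x k)⁻¹ * ∏ i, (x k + η - y i)) := by
  classical
  set p := Lagrange.nodal Finset.univ (fun i => y i - η) - Lagrange.nodal Finset.univ x with hp
  have hdeg : p.degree < (Finset.univ : Finset (Fin N)).card := by
    rw [hp, ← Lagrange.degree_nodal (v := fun i => y i - η)]
    refine Polynomial.degree_sub_lt_left ?_ ?_ ?_
    · simp [Lagrange.degree_nodal]
    · exact Lagrange.nodal_ne_zero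
    · rw [Lagrange.nodal_monic.leadingCoeff, Lagrange.nodal_monic.leadingCoeff]
  have h1 := congrArg (Polynomial.eval z) (Lagrange.eq_interpolate hx.injOn hdeg)
  rw [Lagrange.eval_interpolate_not_at_node _ (fun i _ => hz i)] at h1
  have h2 : ∀ k, Polynomial.eval (x k) p = ∏ i, (x k + η - y i) := by
    intro k
    rw [hp, Polynomial.eval_sub, Lagrange.eval_nodal_at_node (Finset.mem_univ k), sub_zero,
      Lagrange.eval_nodal]
    exact Finset.prod_congr rfl fun i _ => by ring
  simp only [h2] at h1
  rw [hp, Polynomial.eval_sub, Lagrange.eval_nodal, Lagrange.eval_nodal] at h1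
  have h3 : ∏ i, (z + η - y i) = ∏ i, (z - (y i - η)) :=
    Finset.prod_congr rfl fun i _ => by ring
  rw [h3]
  linear_combination h1

theorem sum_nodalWeight_mul_tt {N : ℕ} (η : ℂ) (hη : η ≠ 0) (x y : Fin N → ℂ)
    (hx : Function.Injective x) (hxy : ∀ k j, x k ≠ y j) (hxy' : ∀ k j, x k - y j + η ≠ 0)
    (j : Fin N) :
    ∑ k, (Lagrange.nodalWeight Finset.univ x k * ∏ i, (x k + η - y i)) * tt η (x k) (y j) =
      -η * (∏ i, (y j + η - y i)) / ∏ k, (y j - x k) := by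
  have h0 : (∏ k, (y j - x k)) ≠ 0 :=
    Finset.prod_ne_zero_iff.2 fun k _ => sub_ne_zero.2 (hxy k j).symm
  have hne : ∀ k, y j - η - x k ≠ 0 := fun k h => hxy' k j (by linear_combination -h)
  have h0' : (∏ k, (y j - η - x k)) ≠ 0 := Finset.prod_ne_zero_iff.2 fun k _ => hne k
  have e1 := prod_div_eq_one_add_sum η x y hx (y j) (fun k => (hxy k j).symm)
  have e2 := prod_div_eq_one_add_sum η x y hx (y j - η) (fun k => sub_ne_zero.1 (hne k))
  rw [Finset.prod_eq_zero (Finset.mem_univ j) (by ring)] at e2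
  have e3 := (mul_eq_zero.1 e2.symm).resolve_left h0'
  rw [e1, ← sub_zero (1 + _), ← e3, add_sub_add_left_eq_sub, ← Finset.sum_sub_distrib,
    mul_left_comm, mul_div_cancel_left₀ _ h0, Finset.mul_sum]
  refine Finset.sum_congr rfl fun k _ => ?_
  have a1 := sub_ne_zero.2 (hxy k j)
  have a2 := hxy' k j
  have a3 := sub_ne_zero.2 (hxy k j).symm
  have a4 := hne k
  have : tt η (x k) (y j) = -η * ((y j - x k)⁻¹ - (y j - η - x k)⁻¹) := by
    rw [tt, ← neg_sub (x k), show y j - η - x k = -(x k - y j + η) by ring]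
    field_simp
    ring
  rw [this]; ring

theorem Kc_succ {N : ℕ} (η : ℂ) (hη : η ≠ 0) (x y : Fin (N + 1) → ℂ)
    (hx : Function.Injective x) (hy : Function.Injective y)
    (hxy : ∀ k j, x k ≠ y j) (hxy' : ∀ k j, x k - y j + η ≠ 0) :
    Kc η (N + 1) x y = ∑ j, gg η (x 0) (y j) * (∏ i, ff η (y j) (y (j.succAbove i))) *
      (∏ k : Fin N, ff η (x k.succ) (y j)) *
      Kc η N (fun k => x k.succ) (fun i => y (j.succAbove i)) := by
  set r : Fin (N + 1) → ℂ :=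
    fun k => Lagrange.nodalWeight Finset.univ x k * ∏ i, (x k + η - y i) with hr
  have hr0 : r 0 = (∏ k : Fin N, (x 0 - x k.succ)⁻¹) * ∏ i, (x 0 + η - y i) := by
    simp only [hr, Lagrange.nodalWeight]
    congr 1
    rw [Fin.univ_succ]
    simp
  have hr0ne : r 0 ≠ 0 := by
    rw [hr0]
    refine mul_ne_zero (Finset.prod_ne_zero_iff.2 fun k _ => inv_ne_zero (sub_ne_zero.2
      fun h => (Fin.succ_ne_zero k) (hx h).symm)) (Finset.prod_ne_zero_iff.2 fun i _ h => ?_)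
    exact hxy' 0 i (by linear_combination h)
  have hdet := Matrix.det_updateRow_sum
    (Matrix.of fun j k : Fin (N + 1) => tt η (x j) (y k)) 0 r
  rw [Matrix.det_succ_row_zero] at hdet
  refine mul_left_cancel₀ hr0ne ?_
  rw [Kc, mul_left_comm, ← smul_eq_mul (r 0) (Matrix.det _), ← hdet, Finset.mul_sum,
    Finset.mul_sum]
  refine Finset.sum_congr rfl fun j _ => ?_
  have hsub : (Matrix.updateRow (Matrix.of fun j k : Fin (N + 1) => tt η (x j) (y k)) 0
      (∑ k, r k • (Matrix.of fun j k : Fin (N + 1) => tt η (x j) (y k)) k)).submatrix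
      Fin.succ j.succAbove = Matrix.of fun a b : Fin N => tt η (x a.succ) (y (j.succAbove b)) := by
    ext a b
    simp
  rw [hsub, Matrix.updateRow_self]
  simp only [Finset.sum_apply, Pi.smul_apply, smul_eq_mul, Matrix.of_apply]
  rw [hr, sum_nodalWeight_mul_tt η hη x y hx hxy hxy' j, ← hr, Delta'_succ, Delta_succAbove η y j,
    Kc, hr0]
  have hhprod : ∏ k, ∏ i, hh η (x k) (y i) =
      (hh η (x 0) (y j) * ∏ i, hh η (x 0) (y (j.succAbove i))) *
        ((∏ k : Fin N, hh η (x k.succ) (y j)) *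
          ∏ k : Fin N, ∏ i, hh η (x k.succ) (y (j.succAbove i))) := by
    simp only [Fin.prod_univ_succAbove (fun i => hh η _ (y i)) j, Fin.prod_univ_succ (n := N),
      Finset.prod_mul_distrib]
  simp only [Fin.prod_univ_succ (n := N) (f := fun k => y j - x k),
    Fin.prod_univ_succAbove (fun i => y j + η - y i) j,
    Fin.prod_univ_succAbove (fun i => x 0 + η - y i) j, hhprod]
  set D := Matrix.det (Matrix.of fun a b : Fin N => tt η (x a.succ) (y (j.succAbove b)))
  have hyj : ∀ k, y j - x k ≠ 0 := fun k => sub_ne_zero.2 (hxy k j).symm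
  have hP : (∏ k : Fin N, (y j - x k.succ)) ≠ 0 := Finset.prod_ne_zero_iff.2 fun k _ => hyj _
  have hsign : ((-1 : ℂ) ^ (j : ℕ)) * (-1) ^ (j : ℕ) = 1 := by
    rw [← mul_pow]; norm_num
  have k1 : (∏ k : Fin N, gg η (x 0) (x k.succ)) * (∏ k : Fin N, hh η (x k.succ) (y j)) *
      (-1) ^ N = (∏ k : Fin N, (x 0 - x k.succ)⁻¹) * (∏ k : Fin N, ff η (x k.succ) (y j)) *
      ∏ k : Fin N, (y j - x k.succ) := by
    have : ((-1 : ℂ)) ^ N = ∏ _k : Fin N, (-1 : ℂ) := by simp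
    rw [this]
    simp only [← Finset.prod_mul_distrib]
    refine Finset.prod_congr rfl fun k _ => ?_
    have := hyj k.succ
    have := sub_ne_zero.2 (hxy k.succ j)
    rw [gg, hh, ff, ← neg_sub (x k.succ) (y j)]
    field_simp
  have k2 : (∏ i, gg η (y j) (y (j.succAbove i))) * (∏ i, hh η (x 0) (y (j.succAbove i))) *
      (∏ i, (y j + η - y (j.succAbove i))) = (∏ i, ff η (y j) (y (j.succAbove i))) *
      ∏ i, (x 0 + η - y (j.succAbove i)) := by
    simp only [← Finset.prod_mul_distrib]
    refine Finset.prod_congr rfl fun i _ => ?_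
    have : y j - y (j.succAbove i) ≠ 0 :=
      sub_ne_zero.2 fun h => Fin.succAbove_ne j i (hy h).symm
    rw [gg, hh, ff]
    field_simp
    ring
  have k3 : hh η (x 0) (y j) * (-η * (y j + η - y j)) = (x 0 + η - y j) * gg η (x 0) (y j) *
      (y j - x 0) := by
    have := sub_ne_zero.2 (hxy 0 j)
    rw [gg, hh]
    field_simp
    ring
  have hE : ∀ q : ℂ, q / ((y j - x 0) * ∏ k : Fin N, (y j - x k.succ)) *
      ((y j - x 0) * ∏ k : Fin N, (y j - x k.succ)) = q :=
    fun q => div_mul_cancel₀ q (mul_ne_zero (hyj 0) hP)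
  refine mul_right_cancel₀ (mul_ne_zero (hyj 0) hP) ?_
  set HH := ∏ k : Fin N, ∏ i, hh η (x k.succ) (y (j.succAbove i))
  set X := ∏ k : Fin N, (y j - x k.succ)
  set Dx := Delta' η fun i : Fin N => x i.succ
  set Dy := Delta η fun i => y (j.succAbove i)
  have hq := hE (-η * ((y j + η - y j) * ∏ i, (y j + η - y (j.succAbove i))))
  set E := -η * ((y j + η - y j) * ∏ i, (y j + η - y (j.succAbove i))) / ((y j - x 0) * X)
  calc _ = ((∏ k : Fin N, gg η (x 0) (x k.succ)) * (∏ k : Fin N, hh η (x k.succ) (y j)) *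
          (-1) ^ N) * ((∏ i, gg η (y j) (y (j.succAbove i))) *
          (∏ i, hh η (x 0) (y (j.succAbove i)))) * hh η (x 0) (y j) *
          ((-1) ^ (j : ℕ) * (-1) ^ (j : ℕ)) * (E * ((y j - x 0) * X)) * (Dx * Dy * HH * D) := by
        ring
    _ = ((∏ k : Fin N, gg η (x 0) (x k.succ)) * (∏ k : Fin N, hh η (x k.succ) (y j)) *
          (-1) ^ N) * ((∏ i, gg η (y j) (y (j.succAbove i))) *
          (∏ i, hh η (x 0) (y (j.succAbove i))) * ∏ i, (y j + η - y (j.succAbove i))) *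
          (hh η (x 0) (y j) * (-η * (y j + η - y j))) * (Dx * Dy * HH * D) := by
        rw [hsign, hq]; ring
    _ = _ := by
        rw [k1, k2, k3]; ring

theorem subT_eq {n : ℕ} (w : Fin n → ℂ) (S : Finset (Fin n)) {N : ℕ} (h : S.card = N) :
    subT w S N = fun i => w (S.orderEmbOfFin h i) := by
  funext i
  have hi : (i : ℕ) < ((S.sort (· ≤ ·)).map w).length := by
    rw [List.length_map, Finset.length_sort, h]; exact i.2
  rw [subT, List.getD_eq_getElem _ _ hi, List.getElem_map, Finset.orderEmbOfFin_apply]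
  rfl

theorem ofFn_subT {n : ℕ} (w : Fin n → ℂ) (S : Finset (Fin n)) {N : ℕ} (h : S.card = N) :
    List.ofFn (subT w S N) = (S.sort (· ≤ ·)).map w := by
  refine List.ext_getElem (by simp [h]) fun i h1 h2 => ?_
  rw [List.getElem_ofFn, subT, List.getD_eq_getElem _ _ h2]

theorem subT_univ {n : ℕ} (w : Fin n → ℂ) : subT w Finset.univ n = w := by
  funext i
  rw [subT_eq w _ (Finset.card_fin n)]
  have := Finset.orderEmbOfFin_unique (s := Finset.univ) (Finset.card_fin n) (f := id)
    (fun _ => Finset.mem_univ _) strictMono_id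
  rw [← this]; rfl

theorem Kc_eq_recK {n : ℕ} (η : ℂ) (hη : η ≠ 0) (v : Fin n → ℂ) (hv : Function.Injective v)
    {N : ℕ} (x : Fin N → ℂ) (T : Finset (Fin n)) (hT : T.card = N) (hx : Function.Injective x)
    (hxv : ∀ k j, x k ≠ v j) (hxv' : ∀ k j, x k - v j + η ≠ 0) :
    Kc η N x (subT v T N) = recK η v (List.ofFn x) T := by
  induction N generalizing T with
  | zero =>
    rw [Finset.card_eq_zero] at hT
    simp [Kc, Delta, Delta', recK, hT]
  | succ N ih =>
    rw [subT_eq v T hT, Kc_succ η hη x (fun i => v (T.orderEmbOfFin hT i)) hx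
      (hv.comp (T.orderEmbOfFin hT).injective)
      (fun k j => hxv _ _) (fun k j => hxv' _ _), List.ofFn_succ, recK]
    refine Finset.sum_bij (fun j _ => T.orderEmbOfFin hT j)
      (fun j _ => Finset.orderEmbOfFin_mem _ _ _)
      (fun _ _ _ _ h => (T.orderEmbOfFin hT).injective h)
      (fun b hb => ?_) (fun j _ => ?_)
    · have : b ∈ Set.range (T.orderEmbOfFin hT) := by
        rw [Finset.range_orderEmbOfFin]; exact hb
      obtain ⟨a, ha⟩ := this
      exact ⟨a, Finset.mem_univ _, ha⟩
    · have hc : (T.erase (T.orderEmbOfFin hT j)).card = N := by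
        rw [Finset.card_erase_of_mem (Finset.orderEmbOfFin_mem _ _ _), hT]; rfl
      have hemb := Finset.orderEmbOfFin_unique hc
        (f := fun i => T.orderEmbOfFin hT (j.succAbove i))
        (fun i => Finset.mem_erase.2 ⟨fun h => Fin.succAbove_ne j i
          ((T.orderEmbOfFin hT).injective h), Finset.orderEmbOfFin_mem _ _ _⟩)
        ((T.orderEmbOfFin hT).strictMono.comp (Fin.strictMono_succAbove j))
      rw [← ih (fun k => x k.succ) _ hc (hx.comp (Fin.succ_injective N)) (fun k => hxv _)
        (fun k => hxv' _), subT_eq v _ hc, ← hemb, List.map_ofFn, List.prod_ofFn]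
      have himg : T.erase (T.orderEmbOfFin hT j) = Finset.univ.map
          ((T.erase (T.orderEmbOfFin hT j)).orderEmbOfFin hc).toEmbedding := by
        rw [Finset.map_orderEmbOfFin_univ]
      have hprod : ∏ i ∈ T.erase (T.orderEmbOfFin hT j), ff η (v (T.orderEmbOfFin hT j)) (v i) =
          ∏ i, ff η (v (T.orderEmbOfFin hT j)) (v (T.orderEmbOfFin hT (j.succAbove i))) := by
        rw [himg, Finset.prod_map]
        refine Finset.prod_congr rfl fun i _ => ?_
        rw [funext_iff] at hemb
        rw [hemb i]; rfl
      rw [hprod]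
      rfl

end Recursion

section Weights

theorem Delta'_mul_Delta_comm (η : ℂ) {N : ℕ} (x y : Fin N → ℂ) :
    Delta' η x * Delta η y = Delta' η y * Delta η x := by
  simp only [Delta, Delta', ← Finset.prod_mul_distrib]
  refine Finset.prod_congr rfl fun a _ => Finset.prod_congr rfl fun b _ => ?_
  rw [gg_swap η (x a), gg_swap η (y b)]
  ring

theorem ff_mul_hh_sub (η a b : ℂ) (hη : η ≠ 0) (hab : a ≠ b) :
    ff η b a * hh η (a - η) b = -hh η b a := by
  have := sub_ne_zero.2 hab.symm
  rw [ff, hh, hh]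
  field_simp
  ring

theorem tt_sub (η a b : ℂ) : tt η (a - η) b = tt η b a := by
  rw [tt, tt]
  congr 1
  ring

theorem Kc_swap (η : ℂ) (hη : η ≠ 0) {N : ℕ} (y α : Fin N → ℂ) (hαy : ∀ k j, α k ≠ y j) :
    Kc η N y α = (-1) ^ N * (∏ j, ∏ k, ff η (y j) (α k)) * Kc η N (fun k => α k - η) y := by
  have hdet : Matrix.det (Matrix.of fun k j : Fin N => tt η (α k - η) (y j)) =
      Matrix.det (Matrix.of fun j k : Fin N => tt η (y j) (α k)) := by
    rw [← Matrix.det_transpose]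
    congr 1
    ext j k
    simp [tt_sub]
  have hD : Delta' η (fun k => α k - η) = Delta' η α := by
    simp only [Delta', gg, sub_sub_sub_cancel_right]
  have hprod : (∏ j, ∏ k, ff η (y j) (α k)) * ∏ k, ∏ j, hh η (α k - η) (y j) =
      (-1) ^ (N * N) * ∏ j, ∏ k, hh η (y j) (α k) := by
    rw [Finset.prod_comm (f := fun k j => hh η (α k - η) (y j)),
      show ((-1 : ℂ)) ^ (N * N) = ∏ _j : Fin N, ∏ _k : Fin N, (-1 : ℂ) by simp [pow_mul]]
    simp only [← Finset.prod_mul_distrib]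
    refine Finset.prod_congr rfl fun j _ => Finset.prod_congr rfl fun k _ => ?_
    rw [ff_mul_hh_sub η _ _ hη (hαy k j)]
    ring
  have hsign : ((-1 : ℂ)) ^ N * (-1) ^ (N * N) = 1 := by
    rw [← pow_add, Even.neg_one_pow]
    rw [add_comm, ← Nat.mul_succ]
    exact Nat.even_mul_succ_self N
  rw [Kc, Kc, hdet, hD, Delta'_mul_Delta_comm η y α]
  set D := Matrix.det (Matrix.of fun j k : Fin N => tt η (y j) (α k))
  linear_combination -(Delta' η α * Delta η y * D) * ((-1) ^ N * hprod +
    (∏ j, ∏ k, hh η (y j) (α k)) * hsign)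

theorem prod_subT {n : ℕ} (w : Fin n → ℂ) (S : Finset (Fin n)) {N : ℕ} (h : S.card = N)
    (F : ℂ → ℂ) : ∏ i, F (subT w S N i) = ∏ a ∈ S, F (w a) := by
  rw [subT_eq w S h]
  conv_rhs => rw [← Finset.map_orderEmbOfFin_univ S h, Finset.prod_map]
  rfl

theorem subT_injective {n : ℕ} (w : Fin n → ℂ) (hw : Function.Injective w) (S : Finset (Fin n))
    {N : ℕ} (h : S.card = N) : Function.Injective (subT w S N) := by
  rw [subT_eq w S h]
  exact hw.comp (S.orderEmbOfFin h).injective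

/-- Summation over the partitions of `v̄` at a fixed partition of `ū`. -/
theorem sum_partitions_Kc {n m : ℕ} (η : ℂ) (hη : η ≠ 0) (u : Fin n → ℂ) (v : Fin m → ℂ)
    (hu : Function.Injective u) (hv : Function.Injective v)
    (huv : ∀ a b, u a ≠ v b) (huvη : ∀ a b, u a - v b ≠ η ∧ u a - v b ≠ -η)
    (S R : Finset (Fin n)) (hSR : R.card = m - S.card) :
    ∑ T ∈ Finset.powersetCard S.card (Finset.univ : Finset (Fin m)),
      Kc η S.card (subT v T S.card) (subT u S S.card) *
        Kc η (m - S.card) (subT u R (m - S.card)) (subT v Tᶜ (m - S.card)) *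
        (∏ a ∈ Tᶜ, ∏ b ∈ T, ff η (v a) (v b)) =
    (-1) ^ S.card * (∏ i ∈ S, ∏ b, ff η (v b) (u i)) *
      recK η v ((R.sort (· ≤ ·)).map u ++ (S.sort (· ≤ ·)).map fun a => u a - η)
        Finset.univ := by
  have hne : ∀ a b, u a - η - v b ≠ 0 := fun a b h => (huvη a b).1 (by linear_combination h)
  have hne' : ∀ a b, u a - v b + η ≠ 0 := fun a b h => (huvη a b).2 (by linear_combination h)
  have hinv : ∀ a b, ff η (v b) (u a) * ff η (u a - η) (v b) = 1 := by
    intro a b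
    have h1 := sub_ne_zero.2 (huv a b)
    have h2 := sub_ne_zero.2 (huv a b).symm
    have h3 := hne a b
    rw [ff, ff, div_mul_div_comm, div_eq_one_iff_eq (mul_ne_zero h2 h3)]
    ring
  rw [recK_append, Finset.mul_sum]
  refine Finset.sum_subset_zero_on_sdiff ?_ ?_ ?_
  · intro T _
    simp
  · intro T hT
    rw [recK_eq_zero_of_card_ne]
    · simp
    · rw [List.length_map, Finset.length_sort]
      intro h
      simp [Finset.mem_powersetCard, h] at hT
  · intro T hT
    have hTc : T.card = S.card := (Finset.mem_powersetCard.1 hT).2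
    have hTc' : Tᶜ.card = m - S.card := by
      rw [Finset.card_compl, Fintype.card_fin, hTc]
    have hsubη : (fun k => subT u S S.card k - η) = subT (fun a => u a - η) S S.card := by
      rw [subT_eq u S rfl, subT_eq _ S rfl]
    have hmem : ∀ (R : Finset (Fin n)) (N : ℕ), R.card = N → ∀ k, ∃ a, subT u R N k = u a :=
      fun R N h k => ⟨R.orderEmbOfFin h k, by rw [subT_eq u R h]⟩
    rw [Kc_swap η hη, hsubη,
      Kc_eq_recK η hη v hv (subT (fun a => u a - η) S S.card) T hTc
        (subT_injective _ (fun a b h => hu (sub_left_injective h)) S rfl)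
        (by rw [← hsubη]; intro k j; obtain ⟨a, ha⟩ := hmem S _ rfl k
            simp only [ha]; exact sub_ne_zero.1 (hne a j))
        (by rw [← hsubη]; intro k j; obtain ⟨a, ha⟩ := hmem S _ rfl k
            simp only [ha]
            have := sub_ne_zero.2 (huv a j)
            intro h; exact this (by linear_combination h)),
      Kc_eq_recK η hη v hv (subT u R (m - S.card)) Tᶜ hTc' (subT_injective _ hu R hSR)
        (by intro k j; obtain ⟨a, ha⟩ := hmem R _ hSR k
            rw [ha]; exact huv a j)
        (by intro k j; obtain ⟨a, ha⟩ := hmem R _ hSR k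
            rw [ha]; exact hne' a j),
      ofFn_subT _ S rfl, ofFn_subT u R hSR]
    · have hff : ∏ j, ∏ k, ff η (subT v T S.card j) (subT u S S.card k) =
          (∏ i ∈ S, ∏ b, ff η (v b) (u i)) *
            ∏ a ∈ Tᶜ, (((S.sort (· ≤ ·)).map fun a => u a - η).map
              fun x => ff η x (v a)).prod := by
        rw [prod_subT v T hTc (fun z => ∏ k, ff η z (subT u S S.card k))]
        have e1 : ∀ a, (((S.sort (· ≤ ·)).map fun a => u a - η).map
              fun x => ff η x (v a)).prod = ∏ i ∈ S, ff η (u i - η) (v a) := by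
          intro a
          rw [← ofFn_subT (fun a => u a - η) S rfl, List.map_ofFn, List.prod_ofFn]
          exact prod_subT (fun a => u a - η) S rfl (fun z => ff η z (v a))
        have e2 : ∀ b, ∏ k, ff η (v b) (subT u S S.card k) = ∏ i ∈ S, ff η (v b) (u i) :=
          fun b => prod_subT u S rfl (fun z => ff η (v b) z)
        simp only [e1, e2]
        rw [Finset.prod_comm (s := S), ← Finset.prod_mul_prod_compl T, mul_assoc,
          ← Finset.prod_mul_distrib]
        simp [← Finset.prod_mul_distrib, hinv]
      rw [hff, ← Finset.compl_eq_univ_sdiff]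
      ring
    · intro k j
      obtain ⟨a, ha⟩ := hmem S _ rfl k
      rw [ha, subT_eq v T hTc]
      exact huv _ _

theorem prod_prod_eq_prod_lt {N : ℕ} (G : Fin N → Fin N → ℂ) (hG : ∀ a, G a a = 1) :
    ∏ a, ∏ b, G a b = ∏ a, ∏ b ∈ Finset.univ.filter (fun b => a < b), (G a b * G b a) := by
  simp only [Finset.prod_filter]
  have h : ∀ a b, G a b = (if a < b then G a b else 1) * (if b < a then G a b else 1) := by
    intro a b
    rcases lt_trichotomy a b with h | h | h
    · simp [h, h.not_gt]
    · subst h; simp [hG]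
    · simp [h, h.not_gt]
  conv_lhs => enter [2, a, 2, b]; rw [h]
  simp only [Finset.prod_mul_distrib]
  rw [Finset.prod_comm (f := fun a b => if b < a then G a b else 1)]
  simp only [← Finset.prod_mul_distrib]
  refine Finset.prod_congr rfl fun a _ => Finset.prod_congr rfl fun b _ => ?_
  split_ifs <;> simp

theorem Delta'_eq_Delta'_shift {N : ℕ} (η : ℂ) (u : Fin N → ℂ)
    (s : Finset (Fin N)) (hu : Function.Injective u) (huη : ∀ a b, a ≠ b → u a - u b + η ≠ 0) :
    Delta' η u = Delta' η (fun i => if i ∈ s then u i - η else u i) *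
      ∏ i ∈ s, ∏ j ∈ sᶜ, ff η (u j) (u i) := by
  have h1 : ∏ i ∈ s, ∏ j ∈ sᶜ, ff η (u j) (u i) =
      ∏ i, ∏ j, if i ∈ s ∧ j ∉ s then ff η (u j) (u i) else 1 := by
    rw [← Finset.prod_subset (Finset.subset_univ s)]
    · refine Finset.prod_congr rfl fun i hi => ?_
      rw [← Finset.prod_subset (Finset.subset_univ sᶜ)]
      · refine Finset.prod_congr rfl fun j hj => ?_
        rw [if_pos ⟨hi, Finset.mem_compl.1 hj⟩]
      · intro j _ hj
        rw [if_neg fun h => hj (Finset.mem_compl.2 h.2)]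
    · intro i _ hi
      exact Finset.prod_eq_one fun j _ => if_neg fun h => hi h.1
  rw [h1, prod_prod_eq_prod_lt _ (fun a => if_neg fun h => h.2 h.1), Delta', Delta']
  simp only [← Finset.prod_mul_distrib]
  refine Finset.prod_congr rfl fun a _ => Finset.prod_congr rfl fun b hb => ?_
  have hab : a ≠ b := (Finset.mem_filter.1 hb).2.ne
  have k1 := huη a b hab
  have k2 := huη b a hab.symm
  have k3 : u a - u b ≠ 0 := sub_ne_zero.2 fun h => hab (hu h)
  have k4 : u b - u a ≠ 0 := sub_ne_zero.2 fun h => hab (hu h).symm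
  have k5 : u a - η - u b ≠ 0 := fun h => k2 (by linear_combination -h)
  have k6 : u a - (u b - η) ≠ 0 := fun h => k1 (by linear_combination h)
  by_cases ha : a ∈ s <;> by_cases hb : b ∈ s <;> simp only [ha, hb, gg, ff, if_true, if_false,
    not_true, not_false_eq_true, and_true, and_false, mul_one, one_mul, sub_sub_sub_cancel_right]
  · rw [div_mul_div_comm, div_eq_div_iff k3 (mul_ne_zero k5 k4)]
    ring
  · rw [div_mul_div_comm, div_eq_div_iff k3 (mul_ne_zero k6 k3)]
    ring

theorem weight_identity {m : ℕ} (η : ℂ) (hη : η ≠ 0) (w : ℂ) (u v : Fin m → ℂ)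
    (s : Finset (Fin m)) (hu : Function.Injective u) (huη : ∀ a b, a ≠ b → u a - u b + η ≠ 0)
    (hwu : ∀ i, w ≠ u i) (hwuη : ∀ i, w - u i + η ≠ 0)
    (huv : ∀ a b, u a ≠ v b) (huvη : ∀ a b, u a - v b + η ≠ 0) :
    (∏ i, gg η w (u i)) * (Delta' η v * Delta η u) * (∏ i, ∏ b, hh η (u i) (v b)) *
      (∏ i, hh η w (u i)) *
      (∏ i ∈ s, -(((hh η (u i) w * ∏ l, hh η (u i) (u l)) * ∏ b, hh η (v b) (u i)) /
        ((hh η w (u i) * ∏ l, hh η (u l) (u i)) * ∏ b, hh η (u i) (v b)))) =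
    (-1) ^ s.card * (∏ i ∈ s, ∏ b, ff η (v b) (u i)) *
      (∏ i ∈ s, ∏ j ∈ sᶜ, ff η (u i) (u j)) * (∏ i ∈ s, ff η (u i) w) *
      (∏ j ∈ sᶜ, ff η w (u j)) *
      (Delta' η (fun i => if i ∈ s then u i - η else u i) * Delta η v *
        ∏ i, ∏ b, hh η (if i ∈ s then u i - η else u i) (v b)) := by
  have hhu : ∀ a b, hh η (u a) (u b) ≠ 0 := by
    intro a b
    by_cases hab : a = b
    · subst hab; simp [hh, hη]
    · exact div_ne_zero (huη a b hab) hη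
  have hself : ∏ i ∈ s, ∏ l ∈ s, hh η (u i) (u l) = ∏ i ∈ s, ∏ l ∈ s, hh η (u l) (u i) :=
    Finset.prod_comm
  have hself0 : ∏ i ∈ s, ∏ l ∈ s, hh η (u l) (u i) ≠ 0 :=
    Finset.prod_ne_zero_iff.2 fun i _ => Finset.prod_ne_zero_iff.2 fun l _ => hhu l i
  have hc : (∏ i ∈ s, -(((hh η (u i) w * ∏ l, hh η (u i) (u l)) * ∏ b, hh η (v b) (u i)) /
        ((hh η w (u i) * ∏ l, hh η (u l) (u i)) * ∏ b, hh η (u i) (v b)))) =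
      ∏ i ∈ s, -(((hh η (u i) w * ∏ j ∈ sᶜ, hh η (u i) (u j)) * ∏ b, hh η (v b) (u i)) /
        ((hh η w (u i) * ∏ j ∈ sᶜ, hh η (u j) (u i)) * ∏ b, hh η (u i) (v b))) := by
    simp only [← Finset.prod_mul_prod_compl s (fun l => hh η _ (u l)),
      ← Finset.prod_mul_prod_compl s (fun l => hh η (u l) _), Finset.prod_neg,
      Finset.prod_div_distrib, Finset.prod_mul_distrib]
    rw [hself]
    congr 1
    rw [mul_left_comm, mul_assoc, mul_left_comm (∏ i ∈ s, hh η w (u i)),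
      mul_assoc (∏ i ∈ s, ∏ l ∈ s, hh η (u l) (u i)), mul_div_mul_left _ _ hself0]
  have hterm : ∀ i ∈ s, gg η w (u i) * (∏ j ∈ sᶜ, ff η (u j) (u i)) *
      (∏ b, hh η (u i) (v b)) * hh η w (u i) *
      -(((hh η (u i) w * ∏ j ∈ sᶜ, hh η (u i) (u j)) * ∏ b, hh η (v b) (u i)) /
        ((hh η w (u i) * ∏ j ∈ sᶜ, hh η (u j) (u i)) * ∏ b, hh η (u i) (v b))) =
      (-1) ^ (s.card + 1) * (-1 * (∏ b, ff η (v b) (u i)) * (∏ j ∈ sᶜ, ff η (u i) (u j)) *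
        ff η (u i) w * ∏ b, hh η (u i - η) (v b)) := by
    intro i hi
    have p1 : (∏ b, ff η (v b) (u i)) * ∏ b, hh η (u i - η) (v b) =
        (-1) ^ m * ∏ b, hh η (v b) (u i) := by
      rw [show ((-1 : ℂ)) ^ m = ∏ _b : Fin m, (-1 : ℂ) by simp]
      simp only [← Finset.prod_mul_distrib]
      refine Finset.prod_congr rfl fun b _ => ?_
      rw [ff_mul_hh_sub η _ _ hη (huv i b)]; ring
    have p2 : (∏ j ∈ sᶜ, ff η (u j) (u i)) * (∏ j ∈ sᶜ, hh η (u i) (u j)) =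
        (-1) ^ sᶜ.card * (∏ j ∈ sᶜ, ff η (u i) (u j)) * ∏ j ∈ sᶜ, hh η (u j) (u i) := by
      rw [← Finset.prod_const]
      simp only [← Finset.prod_mul_distrib]
      refine Finset.prod_congr rfl fun j hj => ?_
      have hij : i ≠ j := fun h => Finset.mem_compl.1 hj (h ▸ hi)
      have k3 : u i - u j ≠ 0 := sub_ne_zero.2 fun h => hij (hu h)
      rw [ff, ff, hh, hh, ← neg_sub (u i) (u j)]
      field_simp
    have p3 : gg η w (u i) * hh η (u i) w = -ff η (u i) w := by
      have k := sub_ne_zero.2 (hwu i)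
      rw [gg, hh, ff, ← neg_sub w (u i)]
      field_simp
    have n1 : ∏ j ∈ sᶜ, hh η (u j) (u i) ≠ 0 := Finset.prod_ne_zero_iff.2 fun j _ => hhu j i
    have n2 : ∏ b, hh η (u i) (v b) ≠ 0 :=
      Finset.prod_ne_zero_iff.2 fun b _ => div_ne_zero (huvη i b) hη
    have n3 : hh η w (u i) ≠ 0 := div_ne_zero (hwuη i) hη
    have hs : ((-1 : ℂ)) ^ (s.card + 1) * (-1) ^ m = -(-1) ^ sᶜ.card := by
      have : m = s.card + sᶜ.card := by rw [Finset.card_add_card_compl, Fintype.card_fin]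
      rw [← pow_add, show s.card + 1 + m = 2 * s.card + (1 + sᶜ.card) by omega, pow_add, pow_mul,
        pow_add]
      norm_num
    rw [← neg_div, mul_div_assoc', div_eq_iff (mul_ne_zero (mul_ne_zero n3 n1) n2)]
    generalize (∏ b, ff η (v b) (u i)) = V at *
    generalize (∏ b, hh η (u i - η) (v b)) = V' at *
    generalize (∏ b, hh η (v b) (u i)) = V'' at *
    generalize (∏ b, hh η (u i) (v b)) = V3 at *
    generalize (∏ j ∈ sᶜ, ff η (u j) (u i)) = A at *
    generalize (∏ j ∈ sᶜ, hh η (u i) (u j)) = B at *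
    generalize (∏ j ∈ sᶜ, ff η (u i) (u j)) = A' at *
    generalize (∏ j ∈ sᶜ, hh η (u j) (u i)) = B' at *
    calc _ = -(gg η w (u i) * hh η (u i) w) * (A * B) * (V3 * hh η w (u i) * V'') := by ring
      _ = -(-(-1) ^ sᶜ.card) * ff η (u i) w * A' * B' * (V3 * hh η w (u i) * V'') := by
        rw [p3, p2]; ring
      _ = -(-1) ^ (s.card + 1) * ff η (u i) w * A' * B' * (V3 * hh η w (u i)) *
          ((-1) ^ m * V'') := by rw [← hs]; ring
      _ = _ := by rw [← p1]; ring
  have hprod := Finset.prod_congr (rfl : s = s) hterm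
  simp only [Finset.prod_mul_distrib, Finset.prod_const] at hprod
  have hsgn : (((-1 : ℂ)) ^ (s.card + 1)) ^ s.card = 1 := by
    rw [← pow_mul, Even.neg_one_pow]
    rw [mul_comm]; exact Nat.even_mul_succ_self _
  rw [hsgn, one_mul] at hprod
  have hcompl : (∏ j ∈ sᶜ, gg η w (u j)) * ∏ j ∈ sᶜ, hh η w (u j) = ∏ j ∈ sᶜ, ff η w (u j) := by
    rw [← Finset.prod_mul_distrib]
    refine Finset.prod_congr rfl fun j _ => ?_
    have := sub_ne_zero.2 (hwu j)
    rw [gg, hh, ff]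
    field_simp
  have hX : ∏ i, ∏ b, hh η (if i ∈ s then u i - η else u i) (v b) =
      (∏ i ∈ s, ∏ b, hh η (u i - η) (v b)) * ∏ i ∈ sᶜ, ∏ b, hh η (u i) (v b) := by
    rw [← Finset.prod_mul_prod_compl s]
    congr 1
    · exact Finset.prod_congr rfl fun i hi => by simp only [if_pos hi]
    · exact Finset.prod_congr rfl fun i hi => by simp only [if_neg (Finset.mem_compl.1 hi)]
  rw [hc, hX, Delta'_mul_Delta_comm η v u, Delta'_eq_Delta'_shift η u s hu huη,
    ← Finset.prod_mul_prod_compl s (fun i => gg η w (u i)),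
    ← Finset.prod_mul_prod_compl s (fun i => hh η w (u i)),
    ← Finset.prod_mul_prod_compl s (fun i => ∏ b, hh η (u i) (v b)), ← hcompl]
  linear_combination (∏ j ∈ sᶜ, gg η w (u j)) * (∏ j ∈ sᶜ, hh η w (u j)) *
    (∏ i ∈ sᶜ, ∏ b, hh η (u i) (v b)) * Delta η v *
    Delta' η (fun i => if i ∈ s then u i - η else u i) * hprod

end Weights

theorem det_smul_add_mul_eq_sum {m : ℕ} (E : ℂ) (c : Fin m → ℂ) (A B : Fin m → Fin m → ℂ) :
    Matrix.det (Matrix.of fun i j => E * A i j + c i * B i j) =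
      ∑ s : Finset (Fin m), E ^ (m - s.card) * (∏ i ∈ s, c i) *
        Matrix.det (Matrix.of fun i j => if i ∈ s then B i j else A i j) := by
  have h := (Matrix.detRowAlternating (n := Fin m) (R := ℂ)).map_add_univ
    (fun i j => c i * B i j) (fun i j => E * A i j)
  have h0 : Matrix.det (Matrix.of fun i j => E * A i j + c i * B i j) =
      Matrix.detRowAlternating ((fun i j => c i * B i j) + fun i j => E * A i j) := by
    refine congrArg Matrix.det ?_
    ext i j
    exact add_comm _ _
  rw [h0, h]
  refine Finset.sum_congr rfl fun s _ => ?_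
  have hprod : E ^ (m - s.card) * ∏ i ∈ s, c i = ∏ i, if i ∈ s then c i else E := by
    rw [← Finset.prod_mul_prod_compl s, mul_comm]
    congr 1
    · exact Finset.prod_congr rfl fun i hi => (if_pos hi).symm
    · rw [Finset.prod_congr rfl fun i hi => if_neg (Finset.mem_compl.1 hi), Finset.prod_const,
        Finset.card_compl, Fintype.card_fin]
  rw [hprod, ← Matrix.det_mul_column]
  refine congrArg Matrix.det ?_
  ext i j
  by_cases hi : i ∈ s <;> simp [hi, Finset.piecewise]

theorem ofFn_shift_perm {m : ℕ} (η : ℂ) (u : Fin (m + 1) → ℂ) (k : Fin (m + 1))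
    (s : Finset (Fin m)) :
    List.Perm (((sᶜ.map k.succAboveEmb).sort (· ≤ ·)).map u ++
      ((s.map k.succAboveEmb).sort (· ≤ ·)).map fun a => u a - η)
      (List.ofFn fun i => if i ∈ s then u (k.succAbove i) - η else u (k.succAbove i)) := by
  rw [← Multiset.coe_eq_coe, ← Multiset.coe_add, ← Multiset.map_coe, ← Multiset.map_coe,
    Finset.sort_eq, Finset.sort_eq, List.ofFn_eq_map, ← Multiset.map_coe,
    Finset.map_val, Finset.map_val, Multiset.map_map, Multiset.map_map]
  have hval : ((List.finRange m : List (Fin m)) : Multiset (Fin m)) = sᶜ.val + s.val := by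
    have h := congrArg Finset.val (Finset.disjUnion_eq_union sᶜ s disjoint_compl_left)
    rw [← Finset.sup_eq_union, compl_sup_eq_top] at h
    exact h.symm
  rw [hval, Multiset.map_add]
  congr 1
  · refine Multiset.map_congr rfl fun i hi => ?_
    have : i ∉ s := Finset.mem_compl.1 hi
    simp [this]
  · refine Multiset.map_congr rfl fun i hi => ?_
    have : i ∈ s := hi
    simp [this]

/-- the sum over partitions `ū ↦ {ū₀,ū₁,ū₂}` (with `#ū₀ = 1`) and
`v̄ ↦ {v̄₁,v̄₂}` (with `#v̄₁ = #ū₁`) of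
`K(v̄₁|ū₁)·K(ū₂|v̄₂)·e^{#ū₂·β}·f(v̄₂,v̄₁)f(ū₁,ū₂)f(ū₁,ū₀)f(ū₀,ū₂)`
equals the determinant representation of the field form factor `Ψ_{m+1}(v̄,ū|β)`. -/
theorem stmt18 (η β : ℂ) (hη : η ≠ 0) (m : ℕ)
    (u : Fin (m + 1) → ℂ) (v : Fin m → ℂ)
    (hu : Function.Injective u) (hv : Function.Injective v)
    (huv : ∀ a b, u a ≠ v b)
    (huη : ∀ a b, a ≠ b → u a - u b ≠ η ∧ u a - u b ≠ -η)
    (hvη : ∀ a b, a ≠ b → v a - v b ≠ η ∧ v a - v b ≠ -η)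
    (huvη : ∀ a b, u a - v b ≠ η ∧ u a - v b ≠ -η) :
    (∑ u0 : Fin (m + 1), ∑ S ∈ (Finset.univ.erase u0).powerset,
      ∑ T ∈ Finset.powersetCard S.card (Finset.univ : Finset (Fin m)),
        Kc η S.card (subT v T S.card) (subT u S S.card) *
          Kc η (m - S.card) (subT u (insert u0 S)ᶜ (m - S.card)) (subT v Tᶜ (m - S.card)) *
          Complex.exp β ^ (m - S.card) *
          (∏ a ∈ Tᶜ, ∏ b ∈ T, ff η (v a) (v b)) *
          (∏ a ∈ S, ∏ b ∈ (insert u0 S)ᶜ, ff η (u a) (u b)) *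
          (∏ a ∈ S, ff η (u a) (u u0)) *
          (∏ b ∈ (insert u0 S)ᶜ, ff η (u u0) (u b)))
      = Psi η β m v u := by
  rw [Psi, Matrix.det_succ_row _ (Fin.last m), Finset.mul_sum]
  refine Finset.sum_congr rfl fun k _ => ?_
  have huη' : ∀ a b, a ≠ b → u a - u b + η ≠ 0 :=
    fun a b hab h => (huη a b hab).2 (by linear_combination h)
  have huvη' : ∀ a b, u a - v b + η ≠ 0 := fun a b h => (huvη a b).2 (by linear_combination h)
  have hinj : Function.Injective fun i => u (k.succAbove i) := hu.comp Fin.succAbove_right_injective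
  set c : Fin m → ℂ := fun i =>
    -(((hh η (u (k.succAbove i)) (u k) * ∏ l, hh η (u (k.succAbove i)) (u (k.succAbove l))) *
      ∏ b, hh η (v b) (u (k.succAbove i))) /
      ((hh η (u k) (u (k.succAbove i)) * ∏ l, hh η (u (k.succAbove l)) (u (k.succAbove i))) *
        ∏ b, hh η (u (k.succAbove i)) (v b))) with hc
  have hminor : ∀ M : Matrix (Fin (m + 1)) (Fin (m + 1)) ℂ,
      (∀ i j, M (Fin.castSucc j) (k.succAbove i) =
        Complex.exp β * tt η (u (k.succAbove i)) (v j) +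
          c i * tt η (v j) (u (k.succAbove i))) →
      (M.submatrix (Fin.last m).succAbove k.succAbove).det =
        ∑ s : Finset (Fin m), Complex.exp β ^ (m - s.card) * (∏ i ∈ s, c i) *
          Matrix.det (Matrix.of fun i j =>
            tt η (if i ∈ s then u (k.succAbove i) - η else u (k.succAbove i)) (v j)) := by
    intro M hM
    have e1 : (M.submatrix (Fin.last m).succAbove k.succAbove).transpose = Matrix.of fun i j =>
        Complex.exp β * tt η (u (k.succAbove i)) (v j) +
          c i * tt η (v j) (u (k.succAbove i)) := by
      ext i j
      simp [hM]
    rw [← Matrix.det_transpose, e1, det_smul_add_mul_eq_sum]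
    refine Finset.sum_congr rfl fun s _ => ?_
    congr 2
    ext i j
    by_cases hi : i ∈ s <;> simp [hi, tt_sub]
  rw [hminor]
  swap
  · intro i j
    simp only [Matrix.of_apply, Fin.val_castSucc, j.2, dif_pos, hc, Fin.eta]
    rw [Fin.prod_univ_succAbove (fun a => hh η (u (k.succAbove i)) (u a)) k,
      Fin.prod_univ_succAbove (fun a => hh η (u a) (u (k.succAbove i))) k]
    ring
  rw [Finset.mul_sum, Finset.mul_sum]
  symm
  refine Finset.sum_bij (fun s _ => s.map k.succAboveEmb) ?_ ?_ ?_ ?_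
  · intro s _
    rw [Finset.mem_powerset]
    intro a ha
    obtain ⟨i, _, rfl⟩ := Finset.mem_map.1 ha
    exact Finset.mem_erase.2 ⟨Fin.succAbove_ne k i, Finset.mem_univ _⟩
  · exact fun s _ s' _ h => Finset.map_injective _ h
  · intro S hS
    refine ⟨Finset.univ.filter fun i => k.succAbove i ∈ S, Finset.mem_univ _, ?_⟩
    ext a
    simp only [Finset.mem_map, Finset.mem_filter, Finset.mem_univ, true_and,
      Fin.succAboveEmb_apply]
    constructor
    · rintro ⟨i, hi, rfl⟩
      exact hi
    · intro ha
      obtain ⟨i, rfl⟩ := Fin.exists_succAbove_eq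
        (Finset.mem_erase.1 (Finset.mem_powerset.1 hS ha)).1
      exact ⟨i, ha, rfl⟩
  · intro s _
    have hR : (insert k (s.map k.succAboveEmb))ᶜ = sᶜ.map k.succAboveEmb := by
      ext a
      rcases eq_or_ne a k with rfl | hak
      · simp [Fin.succAbove_ne]
      · obtain ⟨i, rfl⟩ := Fin.exists_succAbove_eq hak
        simp [Fin.succAbove_ne]
    have hsum := sum_partitions_Kc η hη u v hu hv huv huvη (s.map k.succAboveEmb)
      (sᶜ.map k.succAboveEmb) (by simp [Finset.card_compl])
    have hx1 : ∀ i j, (if i ∈ s then u (k.succAbove i) - η else u (k.succAbove i)) ≠ v j := by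
      intro i j
      split_ifs
      · exact fun h => (huvη (k.succAbove i) j).1 (by linear_combination h)
      · exact huv _ _
    rw [recK_perm η v hv (ofFn_shift_perm η u k s), ← Kc_eq_recK η hη v hv _ _ (Finset.card_fin m),
      subT_univ] at hsum
    · have hw := weight_identity η hη (u k) (fun i => u (k.succAbove i)) v s hinj
        (fun a b hab => huη' _ _ fun h => hab (Fin.succAbove_right_injective h))
        (fun i h => Fin.succAbove_ne k i (hu h).symm)
        (fun i => huη' _ _ (Fin.succAbove_ne k i).symm) (fun _ _ => huv _ _)
        fun _ _ => huvη' _ _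
      have hP : ∏ b, hh η (u k) (v b) ≠ 0 :=
        Finset.prod_ne_zero_iff.2 fun b _ => div_ne_zero (huvη' k b) hη
      have hkk : hh η (u k) (u k) = 1 := by simp [hh, hη]
      have hsq : ((-1 : ℂ)) ^ (m + (k : ℕ)) * (-1) ^ (m + (k : ℕ)) = 1 := by
        rw [← mul_pow]; simp
      have hlast : (∏ a, hh η (u k) (u a)) / (∏ a, hh η (u k) (v a)) * ∏ a, ∏ b, hh η (u a) (v b) =
          (∏ i, hh η (u k) (u (k.succAbove i))) * ∏ i, ∏ b, hh η (u (k.succAbove i)) (v b) := by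
        rw [Fin.prod_univ_succAbove (fun a => hh η (u k) (u a)) k, hkk,
          Fin.prod_univ_succAbove (fun a => ∏ b, hh η (u a) (v b)) k]
        field_simp
      have hfactor : ∀ (P : Finset (Finset (Fin m))) (A B D : Finset (Fin m) → ℂ) (x y z w : ℂ),
          ∑ T ∈ P, A T * B T * x * D T * y * z * w =
            (∑ T ∈ P, A T * B T * D T) * (x * y * z * w) := by
        intro P A B D x y z w
        rw [Finset.sum_mul]
        exact Finset.sum_congr rfl fun T _ => by ring
      rw [hR, hfactor, hsum, Kc, Delta_succAbove η u k, Matrix.of_apply,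
        dif_neg (by simp), Fin.val_last]
      simp only [Finset.prod_map, Finset.card_map, Fin.succAboveEmb_apply]
      change _ * ∏ i ∈ s, c i = _ at hw
      generalize Matrix.det (Matrix.of fun i j =>
        tt η (if i ∈ s then u (k.succAbove i) - η else u (k.succAbove i)) (v j)) = d at *
      generalize (∏ a, hh η (u k) (u a)) / (∏ a, hh η (u k) (v a)) = q at *
      generalize ∏ a, ∏ b, hh η (u a) (v b) = p at *
      generalize ((-1 : ℂ)) ^ (m + (k : ℕ)) = e at *
      linear_combination (Complex.exp β ^ (m - s.card) * d) * hw +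
        (Delta' η v * (∏ i, gg η (u k) (u (k.succAbove i))) *
          Delta η (fun i => u (k.succAbove i)) * Complex.exp β ^ (m - s.card) *
          (∏ i ∈ s, c i) * d) * (hlast + q * p * hsq)
    · intro i j hij
      by_contra hne
      have hne' : k.succAbove i ≠ k.succAbove j := fun h => hne (Fin.succAbove_right_injective h)
      have h0 : u (k.succAbove i) - u (k.succAbove j) ≠ 0 := sub_ne_zero.2 fun h => hne' (hu h)
      have h1 := huη _ _ hne'
      by_cases hi : i ∈ s <;> by_cases hj : j ∈ s <;> simp only [hi, hj, if_true, if_false] at hij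
      · exact h0 (by linear_combination hij)
      · exact h1.1 (by linear_combination hij)
      · exact h1.2 (by linear_combination hij)
      · exact h0 (by linear_combination hij)
    · exact hx1
    · intro i j
      split_ifs
      · rw [sub_right_comm, sub_add_cancel]
        exact sub_ne_zero.2 (huv _ _)
      · exact huvη' _ _
    · intro a ha j
      obtain ⟨i, rfl⟩ := List.mem_ofFn.1 ((ofFn_shift_perm η u k s).mem_iff.1 ha)
      exact hx1 i j
end
end

section
/- Let κ > 0 and L > 0 be real numbers and N ≥ 1 an integer. For β ∈ ℂ, set γ = β/(κL). Then the limit as β → 0 (through nonzero complex values) of π · (N!)² · (e^β − 1) / ( sin(πγ) · Γ(N+γ) · Γ(N−γ) ) · Σ_{k=0}^{N−1} [ (1−γ)_k (1−N)_k / ( (2)_k · k! ) ] · (1 − e^β)^k exists and equals κ L N². (This gives the value (−1)^N κ L N² of the squared norm of the ground-state Bethe vector after multiplying by (−1)^N.) -/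
open Finset

noncomputable section

/-- The quotient of `e^β - 1` by `sin (a β)` tends to `1 / a` as `β → 0`, for `a ≠ 0`. -/
lemma tendsto_exp_sub_one_div_sin {a : ℂ} (ha : a ≠ 0) :
    Filter.Tendsto (fun β : ℂ => (Complex.exp β - 1) / Complex.sin (a * β))
      (nhdsWithin 0 {(0 : ℂ)}ᶜ) (nhds (1 / a)) := by
  have hexp : HasDerivAt Complex.exp 1 0 := by
    simpa using Complex.hasDerivAt_exp 0
  have hsin : HasDerivAt (fun β : ℂ => Complex.sin (a * β)) a 0 := by
    simpa using ((hasDerivAt_id (0 : ℂ)).const_mul a).csin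
  refine (hexp.tendsto_slope.div hsin.tendsto_slope ha).congr' ?_
  filter_upwards [self_mem_nhdsWithin] with β hβ
  have hβ' : β ≠ 0 := hβ
  simp only [Pi.div_apply, slope_def_field, sub_zero, mul_zero, Complex.sin_zero, Complex.exp_zero]
  exact div_div_div_cancel_right₀ hβ' _ _

/-- The Gamma function is continuous at positive integers. -/
lemma continuousAt_Gamma_natCast {N : ℕ} (hN : 1 ≤ N) :
    ContinuousAt Complex.Gamma (N : ℂ) := by
  refine (Complex.differentiableAt_Gamma _ fun m hm => ?_).continuousAt
  have h : ((N + m : ℕ) : ℂ) = 0 := by push_cast; rw [hm]; ring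
  have := Nat.cast_eq_zero.mp h
  omega

/-- with `γ = β/(κL)`, the limit as `β → 0` (through nonzero values) of
`π (N!)² (e^β−1) / (sin(πγ) Γ(N+γ) Γ(N−γ)) · ₂F₁(1−γ,1−N;2;1−e^β)` exists and equals
`κ L N²`. -/
theorem stmt19 (κ L : ℝ) (hκ : 0 < κ) (hL : 0 < L) (N : ℕ) (hN : 1 ≤ N) :
    Filter.Tendsto
      (fun β : ℂ =>
        (Real.pi : ℂ) * (Nat.factorial N : ℂ) ^ 2 * (Complex.exp β - 1) /
            (Complex.sin ((Real.pi : ℂ) * (β / ((κ : ℂ) * (L : ℂ)))) *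
              Complex.Gamma ((N : ℂ) + β / ((κ : ℂ) * (L : ℂ))) *
              Complex.Gamma ((N : ℂ) - β / ((κ : ℂ) * (L : ℂ)))) *
          ∑ k ∈ Finset.range N,
            (ascPochhammer ℂ k).eval (1 - β / ((κ : ℂ) * (L : ℂ))) *
                (ascPochhammer ℂ k).eval (1 - (N : ℂ)) /
                ((ascPochhammer ℂ k).eval 2 * (Nat.factorial k : ℂ)) *
              (1 - Complex.exp β) ^ k)
      (nhdsWithin 0 {(0 : ℂ)}ᶜ)
      (nhds ((κ : ℂ) * (L : ℂ) * (N : ℂ) ^ 2)) := by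
  set c : ℂ := (κ : ℂ) * (L : ℂ) with hc_def
  have hc : c ≠ 0 := by
    simp [hc_def, hκ.ne', hL.ne']
  have hpi : (Real.pi : ℂ) ≠ 0 := by exact_mod_cast Real.pi_ne_zero
  have hratio := tendsto_exp_sub_one_div_sin (div_ne_zero hpi hc)
  have hfact : ((N - 1).factorial : ℂ) ≠ 0 := by exact_mod_cast (N - 1).factorial_ne_zero
  have hGammaN : Complex.Gamma (N : ℂ) = ((N - 1).factorial : ℂ) := by
    obtain ⟨n, rfl⟩ := Nat.exists_eq_add_of_le' hN
    simpa using Complex.Gamma_nat_eq_factorial n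
  have hplus : Filter.Tendsto (fun β : ℂ => Complex.Gamma ((N : ℂ) + β / c))
      (nhdsWithin 0 {(0 : ℂ)}ᶜ) (nhds ((N - 1).factorial : ℂ)) := by
    have h : ContinuousAt (fun β : ℂ => Complex.Gamma ((N : ℂ) + β / c)) 0 :=
      ContinuousAt.comp' (by simpa using continuousAt_Gamma_natCast hN) (by fun_prop)
    simpa [ContinuousAt, hGammaN] using h.tendsto.mono_left nhdsWithin_le_nhds
  have hminus : Filter.Tendsto (fun β : ℂ => Complex.Gamma ((N : ℂ) - β / c))
      (nhdsWithin 0 {(0 : ℂ)}ᶜ) (nhds ((N - 1).factorial : ℂ)) := by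
    have h : ContinuousAt (fun β : ℂ => Complex.Gamma ((N : ℂ) - β / c)) 0 :=
      ContinuousAt.comp' (by simpa using continuousAt_Gamma_natCast hN) (by fun_prop)
    simpa [ContinuousAt, hGammaN] using h.tendsto.mono_left nhdsWithin_le_nhds
  have hsum : Filter.Tendsto (fun β : ℂ => ∑ k ∈ Finset.range N,
      (ascPochhammer ℂ k).eval (1 - β / c) * (ascPochhammer ℂ k).eval (1 - (N : ℂ)) /
        ((ascPochhammer ℂ k).eval 2 * (Nat.factorial k : ℂ)) * (1 - Complex.exp β) ^ k)
      (nhdsWithin 0 {(0 : ℂ)}ᶜ) (nhds 1) := by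
    have h : Continuous (fun β : ℂ => ∑ k ∈ Finset.range N,
      (ascPochhammer ℂ k).eval (1 - β / c) * (ascPochhammer ℂ k).eval (1 - (N : ℂ)) /
        ((ascPochhammer ℂ k).eval 2 * (Nat.factorial k : ℂ)) * (1 - Complex.exp β) ^ k) := by
      fun_prop
    refine (h.tendsto' 0 1 ?_).mono_left nhdsWithin_le_nhds
    rw [Finset.sum_eq_single_of_mem 0 (Finset.mem_range.mpr hN)]
    · simp
    · intro k _ hk
      simp [hk]
  have hlim := ((hratio.const_mul ((Real.pi : ℂ) * (N.factorial : ℂ) ^ 2)).div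
    (hplus.mul hminus) (mul_ne_zero hfact hfact)).mul hsum
  have hvalue : (Real.pi : ℂ) * (N.factorial : ℂ) ^ 2 * (1 / (Real.pi / c)) /
      (((N - 1).factorial : ℂ) * ((N - 1).factorial : ℂ)) * 1 = c * (N : ℂ) ^ 2 := by
    rw [← Nat.mul_factorial_pred (by omega : N ≠ 0)]
    push_cast
    field_simp
  rw [hvalue] at hlim
  refine hlim.congr fun β => ?_
  simp only [Pi.div_apply]
  rw [show (Real.pi : ℂ) / c * β = Real.pi * (β / c) by ring]
  congr 1
  rw [← mul_div_assoc, div_div, mul_assoc (Complex.sin _)]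
end
end
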